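/- arXiv:1812.02067 — 2 statements merged into one kernel-verified Lean document; each statement's English description precedes it below -/
import Mathlib

section
/- For every integer k ≥ 2, the word vtm contains a factor of length k+1 whose first and last letters are equal and belong to {0,2}; that is, there exists i ≥ 0 such that v_i = v_{i+k} and v_i ∈ {0,2}. -/
/-- The morphism μ : 0 ↦ 012, 1 ↦ 02, 2 ↦ 1. -/
def mu : Fin 3 → List (Fin 3)
  | 0 => [0, 1, 2]
  | 1 => [0, 2]
  | 2 => [1]

/-- Apply μ to a finite word. -/
def muWord (l : List (Fin 3)) : List (Fin 3) := l.flatMap mu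

/-- The word vtm = 012021012102012⋯, the fixed point of μ starting with 0,
obtained as the limit of μ^n(0): since μ^m(0) is a prefix of μ^(m+1)(0) and
its length exceeds n for m = n+1, the n-th letter is read off from μ^(n+1)(0). -/
def vtm (n : ℕ) : Fin 3 := ((muWord^[n + 1]) [0]).getD n 0

/-- Thue-Morse sequence. -/
def tmB (n : ℕ) : Bool := Nat.binaryRec false (fun b _ r => xor b r) n

theorem tmB_even (n : ℕ) : tmB (2 * n) = tmB n := by
  have h := Nat.binaryRec_eq (motive := fun _ => Bool) (zero := false)
    (bit := fun b _ r => xor b r) false n (Or.inl rfl)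
  simpa [Nat.bit, tmB] using h

theorem tmB_odd (n : ℕ) : tmB (2 * n + 1) = !tmB n := by
  have h := Nat.binaryRec_eq (motive := fun _ => Bool) (zero := false)
    (bit := fun b _ r => xor b r) true n (Or.inl rfl)
  simpa [Nat.bit, tmB] using h

theorem tmB_even' (n : ℕ) : tmB (2 * n + 2) = tmB (n + 1) := tmB_even (n + 1)

theorem tmB_odd' (n : ℕ) : tmB (2 * n + 3) = !tmB (n + 1) := tmB_odd (n + 1)

theorem tmB_zero : tmB 0 = false := by simp [tmB]

/-- Difference code of two consecutive Thue-Morse letters. -/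
def tmF (a b : Bool) : Fin 3 := if a = b then 1 else if a then 2 else 0

def tmD (n : ℕ) : Fin 3 := tmF (tmB n) (tmB (n + 1))

theorem muWord_range (n : ℕ) : muWord ((List.range n).map tmD) =
    (List.range (2 * n + (tmB n).toNat)).map tmD := by
  induction n with
  | zero => simp [muWord, tmB_zero]
  | succ n ih =>
    have e : muWord ((List.range (n + 1)).map tmD) =
        muWord ((List.range n).map tmD) ++ mu (tmD n) := by
      simp [muWord, List.range_succ]
    rw [e, ih]
    have h0 := tmB_even n
    have h1 := tmB_odd n
    have h2 := tmB_even' n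
    have h3 := tmB_odd' n
    have e2 : 2 * (n + 1) = 2 * n + 1 + 1 := by ring
    rw [e2]
    cases ha : tmB n <;> cases hb : tmB (n + 1) <;>
      simp [List.range_succ, tmD, tmF, ha, hb, h0, h1, h2, h3, mu]

theorem iter_range (m : ℕ) : ∃ L, m < L ∧ muWord^[m] [0] = (List.range L).map tmD := by
  induction m with
  | zero =>
    refine ⟨1, by simp, ?_⟩
    have h1 := tmB_odd 0
    simp [tmB_zero] at h1
    simp [tmD, tmF, tmB_zero, h1]
  | succ m ih =>
    obtain ⟨L, hL, h⟩ := ih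
    refine ⟨2 * L + (tmB L).toNat, by omega, ?_⟩
    rw [Function.iterate_succ_apply', h, muWord_range]

theorem vtm_eq (n : ℕ) : vtm n = tmD n := by
  obtain ⟨L, hL, h⟩ := iter_range (n + 1)
  have hn : n < L := by omega
  simp [vtm, h, List.getD, hn]

theorem tmB_ED (m : ℕ) : (∃ a, tmB a = tmB (a + m)) ∧ (1 ≤ m → ∃ a, tmB a = !tmB (a + m)) := by
  induction m using Nat.strong_induction_on with
  | _ m ih =>
    obtain ⟨r, hr | hr⟩ := Nat.even_or_odd' m
    · refine ⟨?_, fun hm => ?_⟩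
      · by_cases h0 : m = 0
        · exact ⟨0, by simp [h0]⟩
        obtain ⟨a, ha⟩ := (ih r (by omega)).1
        refine ⟨2 * a, ?_⟩
        rw [hr, ← mul_add, tmB_even, tmB_even, ha]
      · obtain ⟨a, ha⟩ := (ih r (by omega)).2 (by omega)
        refine ⟨2 * a, ?_⟩
        rw [hr, ← mul_add, tmB_even, tmB_even, ha]
    · refine ⟨?_, fun hm => ?_⟩
      · by_cases h0 : r = 0
        · refine ⟨1, ?_⟩
          have h1 := tmB_even 1
          simpa [hr, h0] using h1.symm
        obtain ⟨a, ha⟩ := (ih r (by omega)).2 (by omega)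
        refine ⟨2 * a, ?_⟩
        rw [hr, ← add_assoc, ← mul_add, tmB_even, tmB_odd, ha]
      · obtain ⟨a, ha⟩ := (ih r (by omega)).1
        refine ⟨2 * a, ?_⟩
        rw [hr, ← add_assoc, ← mul_add, tmB_even, tmB_odd, ha, Bool.not_not]

theorem tmB_Q (q : ℕ) : ∃ j, tmB j = tmB (j + q) ∧ tmB (j + q + 1) = !tmB (j + q) := by
  obtain ⟨r, hr | hr⟩ := Nat.even_or_odd' q
  · obtain ⟨a, ha⟩ := (tmB_ED r).1
    refine ⟨2 * a, ?_⟩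
    rw [hr, ← mul_add, tmB_even, tmB_even, tmB_odd]
    exact ⟨ha, rfl⟩
  · obtain ⟨a, ha⟩ := (tmB_ED (r + 1)).2 (by omega)
    refine ⟨2 * a + 1, ?_⟩
    rw [hr, show 2 * a + 1 + (2 * r + 1) = 2 * (a + (r + 1)) by ring, tmB_odd, tmB_even, tmB_odd]
    simp [ha]

theorem tmB_P (q : ℕ) (hq : 1 ≤ q) :
    ∃ j, tmB j = !tmB (j + q) ∧ tmB (j + q + 1) = !tmB (j + q) := by
  obtain ⟨r, hr | hr⟩ := Nat.even_or_odd' q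
  · obtain ⟨a, ha⟩ := (tmB_ED r).2 (by omega)
    refine ⟨2 * a, ?_⟩
    rw [hr, ← mul_add, tmB_even, tmB_even, tmB_odd]
    exact ⟨ha, rfl⟩
  · obtain ⟨a, ha⟩ := (tmB_ED (r + 1)).1
    refine ⟨2 * a + 1, ?_⟩
    rw [hr, show 2 * a + 1 + (2 * r + 1) = 2 * (a + (r + 1)) by ring, tmB_odd, tmB_even, tmB_odd]
    simp [ha]

theorem tmB_R (m : ℕ) (hm : 1 ≤ m) :
    ∃ j, tmB j = !tmB (j + m) ∧ tmB (j + m + 1) = tmB (j + m) := by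
  obtain ⟨q, hq | hq⟩ := Nat.even_or_odd' m
  · obtain ⟨j, h1, h2⟩ := tmB_P q (by omega)
    refine ⟨2 * j + 1, ?_⟩
    rw [hq, show 2 * j + 1 + 2 * q = 2 * (j + q) + 1 by ring, tmB_odd, tmB_odd, tmB_even']
    simp [h1, h2]
  · obtain ⟨j, h1, h2⟩ := tmB_Q q
    refine ⟨2 * j, ?_⟩
    rw [hq, show 2 * j + (2 * q + 1) = 2 * (j + q) + 1 by ring, tmB_even, tmB_odd, tmB_even']
    simp [h1, h2]

theorem tmB_main (k : ℕ) (hk : 2 ≤ k) :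
    ∃ i, tmB i = tmB (i + k) ∧ tmB (i + 1) = !tmB i ∧ tmB (i + k + 1) = !tmB i := by
  obtain ⟨m, hm | hm⟩ := Nat.even_or_odd' k
  · obtain ⟨a, ha⟩ := (tmB_ED m).1
    refine ⟨2 * a, ?_⟩
    rw [hm, ← mul_add, tmB_even, tmB_even, tmB_odd, tmB_odd]
    simp [ha]
  · obtain ⟨j, h1, h2⟩ := tmB_R m (by omega)
    refine ⟨2 * j, ?_⟩
    rw [hm, show 2 * j + (2 * m + 1) = 2 * (j + m) + 1 by ring, tmB_even, tmB_odd, tmB_odd,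
      tmB_even']
    simp [h1, h2]

/-- For every k ≥ 2, vtm contains a factor of length k+1 whose first and last
letters are equal and lie in {0,2}. -/
theorem vtm_factor_same_first_last (k : ℕ) (hk : 2 ≤ k) :
    ∃ i : ℕ, vtm i = vtm (i + k) ∧ (vtm i = 0 ∨ vtm i = 2) := by
  obtain ⟨i, h1, h2, h3⟩ := tmB_main k hk
  refine ⟨i, ?_⟩
  rw [vtm_eq, vtm_eq, tmD, tmD, h3, ← h1, h2]
  cases tmB i <;> simp [tmF]
end

section
/- For every i ≥ 0 and every a ≥ 0, if v_i ∈ {0,2} then v_{2^a i} = v_i. -/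
/-- Thue-Morse sequence. -/
def tmSeq (n : ℕ) : Bool := if h : n = 0 then false else xor (tmSeq (n / 2)) (decide (n % 2 = 1))
termination_by n
decreasing_by omega

theorem tmSeq_even (n : ℕ) : tmSeq (2 * n) = tmSeq n := by
  rcases Nat.eq_zero_or_pos n with h | h
  · subst h; rfl
  · rw [tmSeq, dif_neg (by omega)]
    have h1 : 2 * n / 2 = n := by omega
    have h2 : 2 * n % 2 = 0 := by omega
    rw [h1, h2]; simp

theorem tmSeq_odd (n : ℕ) : tmSeq (2 * n + 1) = !tmSeq n := by
  rw [tmSeq, dif_neg (by omega)]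
  have h1 : (2 * n + 1) / 2 = n := by omega
  have h2 : (2 * n + 1) % 2 = 1 := by omega
  rw [h1, h2]; simp

/-- Letter determined by two consecutive Thue-Morse values. -/
def tmLetter : Bool → Bool → Fin 3
  | false, true => 0
  | true, false => 2
  | _, _ => 1

/-- Explicit form of vtm. -/
def tmV (n : ℕ) : Fin 3 := tmLetter (tmSeq n) (tmSeq (n + 1))

theorem tmV_even (n : ℕ) : tmV (2 * n) = tmLetter (tmSeq n) (!tmSeq n) := by
  rw [tmV, tmSeq_even, tmSeq_odd]

theorem tmV_odd (n : ℕ) : tmV (2 * n + 1) = tmLetter (!tmSeq n) (tmSeq (n + 1)) := by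
  rw [tmV, tmSeq_odd, show 2 * n + 1 + 1 = 2 * (n + 1) by ring, tmSeq_even]

theorem muWord_prefix (n : ℕ) : muWord ((List.range n).map tmV) =
    (List.range (2 * n + (tmSeq n).toNat)).map tmV := by
  induction n with
  | zero => simp [muWord, tmSeq]
  | succ n ih =>
    have e0 := tmV_even n
    have e1 := tmV_odd n
    have e2 := tmV_even (n + 1)
    rw [show 2 * (n + 1) = 2 * n + 2 by ring] at e2 ⊢
    rw [List.range_succ, List.map_append, muWord, List.flatMap_append, ← muWord, ih]
    have ev : tmV n = tmLetter (tmSeq n) (tmSeq (n + 1)) := rfl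
    cases h0 : tmSeq n <;> cases h1 : tmSeq (n + 1) <;> rw [h0] at e0 e1 ev <;>
      rw [h1] at e1 e2 ev <;>
      simp [List.range_succ, ev, e0, e1, e2, tmLetter, mu]

theorem muWord_iter (m : ℕ) : ∃ L, m + 1 ≤ L ∧ muWord^[m] [0] = (List.range L).map tmV := by
  induction m with
  | zero => 
    refine ⟨1, le_refl _, ?_⟩
    have := tmV_even 0
    simp [tmSeq, tmLetter] at this
    simp [this]
  | succ m ih =>
    obtain ⟨L, hL, h⟩ := ih
    refine ⟨2 * L + (tmSeq L).toNat, by omega, ?_⟩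
    rw [Function.iterate_succ_apply', h, muWord_prefix]

theorem vtm_eq_tmV (n : ℕ) : vtm n = tmV n := by
  obtain ⟨L, hL, h⟩ := muWord_iter (n + 1)
  have hn : n < L := by omega
  rw [vtm, h]
  simp [List.getD, hn]

/-- If v_i ∈ {0,2} then v_{2^a i} = v_i for every a ≥ 0. -/
theorem vtm_pow_two_mul (i a : ℕ) (h : vtm i = 0 ∨ vtm i = 2) :
    vtm (2 ^ a * i) = vtm i := by
  induction a with
  | zero => simp
  | succ a ih =>
    rw [← ih] at h ⊢
    rw [pow_succ', mul_assoc]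
    generalize 2 ^ a * i = j at h ⊢
    simp only [vtm_eq_tmV] at h ⊢
    rw [tmV_even]
    rw [tmV] at h ⊢
    revert h
    generalize tmSeq j = x
    generalize tmSeq (j + 1) = y
    revert x y
    decide
end
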